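/- (Gordon–Webb–Wolpert, Neumann case) Let Ω_A ⊆ ℝ² be the open region bounded by the simple closed polygonal curve through the vertices (0,0), (1,0), (1.5,0.5), (2,0), (2,1), (1.5,1.5), (0.5,0.5), (0,1) taken in this order, and let Ω_B ⊆ ℝ² be the open region bounded by the simple closed polygonal curve through the vertices (0,0), (0.5,−0.5), (1,0), (0.5,0.5), (1,1), (1,2), (0.5,1.5), (0,2) taken in this order. Then μ_k(Ω_A) = μ_k(Ω_B) for every integer k ≥ 0; i.e., the two (non-isometric) polygons are Neumann isospectral. -/

import Mathlib

open MeasureTheory Real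

/-- The k-th Neumann eigenvalue of the Laplacian on `Ω ⊆ ℝ²` (indexed from `k = 0`), defined
variationally as the infimum, over all `(k+1)`-dimensional subspaces `E` of the space of
restrictions to `Ω` of smooth functions on ℝ², of the supremum of the Rayleigh quotient
`(∫_Ω ‖∇u‖²) / (∫_Ω u²)` over nonzero `u ∈ E`.  A subspace of restrictions is encoded as a
subspace of smooth functions on ℝ² on which the restriction map to `Ω` is injective. -/
noncomputable def neumannEig (Ω : Set (EuclideanSpace ℝ (Fin 2))) (k : ℕ) : ℝ :=
  sInf { r : ℝ | ∃ E : Submodule ℝ (EuclideanSpace ℝ (Fin 2) → ℝ),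
    Module.finrank ℝ E = k + 1 ∧
    (∀ u ∈ E, ContDiff ℝ (⊤ : ℕ∞) u) ∧
    (∀ u ∈ E, Set.EqOn u 0 Ω → u = 0) ∧
    r = sSup { q : ℝ | ∃ u ∈ E, u ≠ (0 : EuclideanSpace ℝ (Fin 2) → ℝ) ∧
        q = (∫ x in Ω, ‖gradient u x‖ ^ 2) / (∫ x in Ω, (u x) ^ 2) } }

/-- The point `(a, b)` of the Euclidean plane. -/
noncomputable def pt (a b : ℝ) : EuclideanSpace ℝ (Fin 2) :=
  (WithLp.equiv 2 (Fin 2 → ℝ)).symm ![a, b]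

/-- The closed triangle with vertices `p`, `q`, `s`. -/
noncomputable def tri (p q s : EuclideanSpace ℝ (Fin 2)) : Set (EuclideanSpace ℝ (Fin 2)) :=
  convexHull ℝ ({p, q, s} : Set (EuclideanSpace ℝ (Fin 2)))

/-- The open region bounded by the simple closed polygonal curve through the vertices
`(0,0), (1,0), (1.5,0.5), (2,0), (2,1), (1.5,1.5), (0.5,0.5), (0,1)` (taken in this order),
realized as the interior of the union of seven closed triangles triangulating it. -/
noncomputable def gwwA : Set (EuclideanSpace ℝ (Fin 2)) :=
  interior (tri (pt 0 0) (pt 0.5 0.5) (pt 0 1) ∪ tri (pt 0 0) (pt 1 0) (pt 0.5 0.5) ∪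
    tri (pt 1 0) (pt 1 1) (pt 0.5 0.5) ∪ tri (pt 1 0) (pt 1.5 0.5) (pt 1 1) ∪
    tri (pt 1.5 0.5) (pt 2 0) (pt 2 1) ∪ tri (pt 1 1) (pt 1.5 0.5) (pt 2 1) ∪
    tri (pt 1 1) (pt 2 1) (pt 1.5 1.5))

/-- The open region bounded by the simple closed polygonal curve through the vertices
`(0,0), (0.5,−0.5), (1,0), (0.5,0.5), (1,1), (1,2), (0.5,1.5), (0,2)` (taken in this order),
realized as the interior of the union of seven closed triangles triangulating it. -/
noncomputable def gwwB : Set (EuclideanSpace ℝ (Fin 2)) :=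
  interior (tri (pt 0 0) (pt 0.5 (-0.5)) (pt 1 0) ∪ tri (pt 0 0) (pt 1 0) (pt 0.5 0.5) ∪
    tri (pt 0 0) (pt 0.5 0.5) (pt 0 1) ∪ tri (pt 0 1) (pt 0.5 0.5) (pt 1 1) ∪
    tri (pt 0 1) (pt 1 1) (pt 0.5 1.5) ∪ tri (pt 0.5 1.5) (pt 1 1) (pt 1 2) ∪
    tri (pt 0 1) (pt 0.5 1.5) (pt 0 2))

open scoped Convolution Topology
open Filter

section Mollification

variable {V : Type*} [NormedAddCommGroup V] [InnerProductSpace ℝ V] [FiniteDimensional ℝ V]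
  [MeasurableSpace V] [BorelSpace V] {μ : Measure V} [μ.IsAddHaarMeasure]

/-- The derivative of the convolution of a bump function with a Lipschitz function is the
convolution of the bump function with the a.e. defined derivative. -/
theorem ContDiffBump.hasFDerivAt_normed_convolution_of_lipschitzWith (φ : ContDiffBump (0 : V))
    {f : V → ℝ} {K : NNReal} (hf : LipschitzWith K f) (x : V) :
    HasFDerivAt (φ.normed μ ⋆[ContinuousLinearMap.lsmul ℝ ℝ, μ] f)
      ((φ.normed μ ⋆[ContinuousLinearMap.lsmul ℝ ℝ, μ] (fderiv ℝ f)) x) x := by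
  have hint : ∀ y, Integrable (fun t => φ.normed μ t • f (y - t)) μ := fun y =>
    ((φ.continuous_normed.smul (hf.continuous.comp (continuous_const.sub continuous_id)))
      ).integrable_of_hasCompactSupport (φ.hasCompactSupport_normed.smul_right)
  have hK : ∀ y, ‖fderiv ℝ f y‖ ≤ K := fun y => norm_fderiv_le_of_lipschitz ℝ hf
  refine (hasFDerivAt_integral_of_dominated_loc_of_lip (μ := μ) (s := Set.univ)
    (F := fun y t => φ.normed μ t • f (y - t))
    (F' := fun t => φ.normed μ t • fderiv ℝ f (x - t)) (bound := fun t => φ.normed μ t * K)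
    univ_mem (Eventually.of_forall fun y => (hint y).aestronglyMeasurable) (hint x) ?_ ?_ ?_ ?_).2
  · exact (φ.continuous_normed.aestronglyMeasurable.smul
      ((measurable_fderiv ℝ f).comp (measurable_const.sub measurable_id)).aestronglyMeasurable)
  · refine Eventually.of_forall fun t => LipschitzOnWith.of_dist_le_mul fun y _ z _ => ?_
    rw [Real.dist_eq, Real.coe_nnabs, abs_of_nonneg (mul_nonneg (φ.nonneg_normed t) K.coe_nonneg),
      ← smul_sub, smul_eq_mul, abs_mul, abs_of_nonneg (φ.nonneg_normed _), mul_assoc]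
    have := hf.dist_le_mul (y - t) (z - t)
    rw [dist_sub_right, Real.dist_eq] at this
    exact mul_le_mul_of_nonneg_left this (φ.nonneg_normed _)
  · exact φ.integrable_normed.mul_const _
  · have h := hf.ae_differentiableAt (μ := μ)
    have h2 : ∀ᵐ t ∂μ, DifferentiableAt ℝ f (x - t) :=
      (Measure.measurePreserving_sub_left μ x).quasiMeasurePreserving.ae h
    filter_upwards [h2] with t ht
    have h3 : HasFDerivAt (fun y => f (y - t)) (fderiv ℝ f (x - t)) x :=
      (hasFDerivAt_comp_sub t).2 ht.hasFDerivAt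
    exact h3.fun_const_smul _

/-- A Lipschitz function is approximated by smooth functions, boundedly and a.e. together with
its derivative. -/
theorem LipschitzWith.exists_contDiff_approx {f : V → ℝ} {K : NNReal} (hf : LipschitzWith K f) :
    ∃ g : ℕ → V → ℝ, (∀ n, ContDiff ℝ (⊤ : ℕ∞) (g n)) ∧ (∀ n x, |g n x - f x| ≤ K) ∧
      (∀ n x, ‖fderiv ℝ (g n) x‖ ≤ K) ∧ (∀ x, Tendsto (fun n => g n x) atTop (𝓝 (f x))) ∧
      ∀ᵐ x ∂μ, Tendsto (fun n => fderiv ℝ (g n) x) atTop (𝓝 (fderiv ℝ f x)) := by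
  let φ : ℕ → ContDiffBump (0 : V) := fun n =>
    { rIn := 1 / ((n : ℝ) + 1) / 2
      rOut := 1 / ((n : ℝ) + 1)
      rIn_pos := by positivity
      rIn_lt_rOut := half_lt_self (by positivity) }
  have hφ : Tendsto (fun n => (φ n).rOut) atTop (𝓝 0) := tendsto_one_div_add_atTop_nhds_zero_nat
  have hφ1 : ∀ n, (φ n).rOut ≤ 1 := fun n => by
    change 1 / ((n : ℝ) + 1) ≤ 1
    rw [div_le_one (by positivity)]; linarith [(Nat.cast_nonneg n : (0 : ℝ) ≤ n)]
  have hK : ∀ y, ‖fderiv ℝ f y‖ ≤ K := fun y => norm_fderiv_le_of_lipschitz ℝ hf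
  have hm : StronglyMeasurable (fderiv ℝ f) := (measurable_fderiv ℝ f).stronglyMeasurable
  have hd := fun n => (φ n).hasFDerivAt_normed_convolution_of_lipschitzWith (μ := μ) hf
  refine ⟨fun n => (φ n).normed μ ⋆[ContinuousLinearMap.lsmul ℝ ℝ, μ] f, fun n => ?_, fun n x => ?_,
    fun n x => ?_, fun x => ?_, ?_⟩
  · exact (φ n).hasCompactSupport_normed.contDiff_convolution_left _ (φ n).contDiff_normed
      hf.continuous.locallyIntegrable
  · rw [← Real.dist_eq]
    refine (φ n).dist_normed_convolution_le hf.continuous.aestronglyMeasurable fun y hy => ?_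
    refine (hf.dist_le_mul y x).trans (mul_le_of_le_one_right K.2 ?_)
    exact (Metric.mem_ball.1 hy).le.trans (hφ1 n)
  · rw [(hd n x).fderiv]
    refine (norm_integral_le_integral_norm _).trans ?_
    calc ∫ t, ‖(ContinuousLinearMap.lsmul ℝ ℝ (φ n |>.normed μ t)) (fderiv ℝ f (x - t))‖ ∂μ
        ≤ ∫ t, (φ n).normed μ t * K ∂μ := by
          refine integral_mono_of_nonneg (Eventually.of_forall fun t => norm_nonneg _)
            ((φ n).integrable_normed.mul_const _) (Eventually.of_forall fun t => ?_)
          simp only [ContinuousLinearMap.lsmul_apply, norm_smul, Real.norm_eq_abs,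
            abs_of_nonneg ((φ n).nonneg_normed _)]
          exact mul_le_mul_of_nonneg_left (hK _) ((φ n).nonneg_normed _)
      _ = K := by rw [integral_mul_const, (φ n).integral_normed, one_mul]
  · exact ContDiffBump.convolution_tendsto_right_of_continuous hφ hf.continuous x
  · have hloc : LocallyIntegrable (fderiv ℝ f) μ :=
      ((locallyIntegrable_const (K : ℝ)).mono hm.aestronglyMeasurable
        (Eventually.of_forall fun y => by simpa using hK y))
    filter_upwards [ContDiffBump.ae_convolution_tendsto_right_of_locallyIntegrable (K := 2) hφ
      (Eventually.of_forall fun n => by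
        change 1 / ((n : ℝ) + 1) ≤ 2 * (1 / ((n : ℝ) + 1) / 2); linarith) hloc] with x hx
    simpa only [(hd _ x).fderiv] using hx

end Mollification

section GramMatrices

theorem eventually_forall_quadForm_pos {ι α : Type*} [Fintype ι] {l : Filter α}
    {M : α → ι → ι → ℝ} {M₀ : ι → ι → ℝ} (h : ∀ i j, Tendsto (fun a => M a i j) l (𝓝 (M₀ i j)))
    (h₀ : ∀ c : ι → ℝ, c ≠ 0 → 0 < ∑ i, ∑ j, c i * c j * M₀ i j) :
    ∀ᶠ a in l, ∀ c : ι → ℝ, c ≠ 0 → 0 < ∑ i, ∑ j, c i * c j * M a i j := by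
  have hM : Tendsto M l (𝓝 M₀) := tendsto_pi_nhds.2 fun i => tendsto_pi_nhds.2 fun j => h i j
  have hQ : Continuous fun p : (ι → ι → ℝ) × (ι → ℝ) =>
      ∑ i, ∑ j, p.2 i * p.2 j * p.1 i j := by fun_prop
  have key : ∀ᶠ N in 𝓝 M₀, ∀ c ∈ Metric.sphere (0 : ι → ℝ) 1,
      0 < ∑ i, ∑ j, c i * c j * N i j := by
    refine (isCompact_sphere (0 : ι → ℝ) 1).eventually_forall_of_forall_eventually fun c hc => ?_
    have hc0 : c ≠ 0 := ne_zero_of_mem_unit_sphere (⟨c, hc⟩ : Metric.sphere (0 : ι → ℝ) 1)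
    exact (hQ.tendsto (M₀, c)).eventually (lt_mem_nhds (h₀ c hc0))
  filter_upwards [hM.eventually key] with a ha c hc
  have hn : 0 < ‖c‖ := norm_pos_iff.2 hc
  have := ha (‖c‖⁻¹ • c) (by simp [norm_smul, hn.ne'])
  have e : ∑ i, ∑ j, (‖c‖⁻¹ • c) i * (‖c‖⁻¹ • c) j * M a i j
      = (‖c‖⁻¹) ^ 2 * ∑ i, ∑ j, c i * c j * M a i j := by
    simp only [Finset.mul_sum, Pi.smul_apply, smul_eq_mul]
    exact Finset.sum_congr rfl fun i _ => Finset.sum_congr rfl fun j _ => by ring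
  rw [e] at this
  exact pos_of_mul_pos_right this (by positivity)

variable {X : Type*} [MeasurableSpace X] {μ : Measure X}
  {H : Type*} [NormedAddCommGroup H] [InnerProductSpace ℝ H]

theorem integrable_inner_of_bounded [IsFiniteMeasure μ] {f g : X → H} {C D : ℝ}
    (hf : AEStronglyMeasurable f μ) (hg : AEStronglyMeasurable g μ)
    (hfC : ∀ᵐ x ∂μ, ‖f x‖ ≤ C) (hgD : ∀ᵐ x ∂μ, ‖g x‖ ≤ D) :
    Integrable (fun x => inner ℝ (f x) (g x)) μ := by
  refine Integrable.of_bound (C := C * D) (hf.inner hg) ?_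
  filter_upwards [hfC, hgD] with x h1 h2
  exact (norm_inner_le_norm _ _).trans
    (mul_le_mul h1 h2 (norm_nonneg _) ((norm_nonneg _).trans h1))

theorem integral_norm_sq_sum_smul [IsFiniteMeasure μ] {ι : Type*} [Fintype ι] {h : ι → X → H}
    {C : ι → ℝ} (hm : ∀ i, AEStronglyMeasurable (h i) μ) (hC : ∀ i, ∀ᵐ x ∂μ, ‖h i x‖ ≤ C i)
    (c : ι → ℝ) :
    ∫ x, ‖∑ i, c i • h i x‖ ^ 2 ∂μ = ∑ i, ∑ j, c i * c j * ∫ x, inner ℝ (h i x) (h j x) ∂μ := by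
  have hint : ∀ i j, Integrable (fun x => inner ℝ (h i x) (h j x)) μ := fun i j =>
    integrable_inner_of_bounded (hm i) (hm j) (hC i) (hC j)
  have : ∀ x, ‖∑ i, c i • h i x‖ ^ 2 = ∑ i, ∑ j, c i * c j * inner ℝ (h i x) (h j x) := fun x => by
    rw [← real_inner_self_eq_norm_sq, sum_inner]
    refine Finset.sum_congr rfl fun i _ => ?_
    rw [inner_sum]
    refine Finset.sum_congr rfl fun j _ => ?_
    rw [real_inner_smul_left, real_inner_smul_right, mul_assoc]
  simp_rw [this]
  rw [integral_finsetSum _ fun i _ => integrable_finsetSum _ fun j _ => (hint i j).const_mul _]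
  refine Finset.sum_congr rfl fun i _ => ?_
  rw [integral_finsetSum _ fun j _ => (hint i j).const_mul _]
  exact Finset.sum_congr rfl fun j _ => integral_const_mul _ _

theorem tendsto_integral_inner_of_bounded [IsFiniteMeasure μ] {f g : ℕ → X → H} {f₀ g₀ : X → H}
    {C D : ℝ} (hf : ∀ n, AEStronglyMeasurable (f n) μ) (hg : ∀ n, AEStronglyMeasurable (g n) μ)
    (hfC : ∀ n, ∀ᵐ x ∂μ, ‖f n x‖ ≤ C) (hgD : ∀ n, ∀ᵐ x ∂μ, ‖g n x‖ ≤ D)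
    (hf₀ : ∀ᵐ x ∂μ, Tendsto (fun n => f n x) atTop (𝓝 (f₀ x)))
    (hg₀ : ∀ᵐ x ∂μ, Tendsto (fun n => g n x) atTop (𝓝 (g₀ x))) :
    Tendsto (fun n => ∫ x, inner ℝ (f n x) (g n x) ∂μ) atTop
      (𝓝 (∫ x, inner ℝ (f₀ x) (g₀ x) ∂μ)) := by
  refine tendsto_integral_of_dominated_convergence (fun _ => C * D)
    (fun n => (hf n).inner (hg n)) (integrable_const _) (fun n => ?_) ?_
  · filter_upwards [hfC n, hgD n] with x h1 h2
    exact (norm_inner_le_norm _ _).trans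
      (mul_le_mul h1 h2 (norm_nonneg _) ((norm_nonneg _).trans h1))
  · filter_upwards [hf₀, hg₀] with x h1 h2 using h1.inner h2

end GramMatrices

section NeumannComparison

local notation "E2" => EuclideanSpace ℝ (Fin 2)

/-- The set of suprema of Rayleigh quotients whose infimum is `neumannEig Ω k`. -/
def rayleighSups (Ω : Set E2) (k : ℕ) : Set ℝ :=
  { r : ℝ | ∃ E : Submodule ℝ (E2 → ℝ),
    Module.finrank ℝ E = k + 1 ∧
    (∀ u ∈ E, ContDiff ℝ (⊤ : ℕ∞) u) ∧
    (∀ u ∈ E, Set.EqOn u 0 Ω → u = 0) ∧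
    r = sSup { q : ℝ | ∃ u ∈ E, u ≠ (0 : E2 → ℝ) ∧
        q = (∫ x in Ω, ‖gradient u x‖ ^ 2) / (∫ x in Ω, (u x) ^ 2) } }

theorem norm_gradient_eq (u : E2 → ℝ) (x : E2) : ‖gradient u x‖ = ‖fderiv ℝ u x‖ := by
  simp [gradient]

theorem measurable_gradient (u : E2 → ℝ) : Measurable (gradient u) :=
  ((InnerProductSpace.toDual ℝ E2).symm.continuous.measurable).comp (measurable_fderiv ℝ u)

theorem gradient_sum_smul {ι : Type*} [Fintype ι] {f : ι → E2 → ℝ} {x : E2}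
    (hf : ∀ i, DifferentiableAt ℝ (f i) x) (c : ι → ℝ) :
    gradient (∑ i, c i • f i) x = ∑ i, c i • gradient (f i) x := by
  have : fderiv ℝ (∑ i, c i • f i) x = ∑ i, c i • fderiv ℝ (f i) x :=
    (HasFDerivAt.sum fun i _ => (hf i).hasFDerivAt.const_smul (c i)).fderiv
  simp [gradient, this, map_sum]

theorem setIntegral_sq_pos {Ω : Set E2} (ho : IsOpen Ω) (hb : Bornology.IsBounded Ω) {u : E2 → ℝ}
    (hu : Continuous u) (h0 : ¬ Set.EqOn u 0 Ω) : 0 < ∫ x in Ω, (u x) ^ 2 := by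
  obtain ⟨x, hx, hxu⟩ : ∃ x ∈ Ω, u x ≠ 0 := by
    simpa [Set.EqOn] using h0
  have hint : IntegrableOn (fun x => (u x) ^ 2) Ω :=
    ((hu.pow 2).continuousOn.integrableOn_compact hb.isCompact_closure).mono_set subset_closure
  rw [setIntegral_pos_iff_support_of_nonneg_ae (Eventually.of_forall fun x => sq_nonneg _) hint]
  have hop : IsOpen (Function.support (fun x => (u x) ^ 2) ∩ Ω) :=
    ((hu.pow 2).isOpen_support).inter ho
  exact hop.measure_pos volume ⟨x, by simpa using hxu, hx⟩

/-- If a linear map `T` sends smooth functions to Lipschitz functions and preserves the `L²` norm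
and the Dirichlet energy, every supremum of Rayleigh quotients on `Ω` is, up to `ε`, bounded below
by one on `Ω'`. -/
theorem exists_rayleighSups_le {Ω Ω' : Set E2} (ho : IsOpen Ω) (hb : Bornology.IsBounded Ω)
    (hb' : Bornology.IsBounded Ω')
    (T : (E2 → ℝ) →ₗ[ℝ] (E2 → ℝ))
    (hLip : ∀ u, ContDiff ℝ (⊤ : ℕ∞) u → ∃ K, LipschitzWith K (T u))
    (hmass : ∀ u, ContDiff ℝ (⊤ : ℕ∞) u → ∫ x in Ω', (T u x) ^ 2 = ∫ x in Ω, (u x) ^ 2)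
    (henergy : ∀ u, ContDiff ℝ (⊤ : ℕ∞) u →
      ∫ x in Ω', ‖gradient (T u) x‖ ^ 2 = ∫ x in Ω, ‖gradient u x‖ ^ 2)
    {k : ℕ} {r : ℝ} (hr : r ∈ rayleighSups Ω k) {ε : ℝ} (hε : 0 < ε) :
    ∃ r' ∈ rayleighSups Ω' k, r' ≤ r + ε := by
  obtain ⟨E, hfin, hsm, hinj, rfl⟩ := hr
  set S := { q : ℝ | ∃ u ∈ E, u ≠ (0 : E2 → ℝ) ∧
        q = (∫ x in Ω, ‖gradient u x‖ ^ 2) / (∫ x in Ω, (u x) ^ 2) } with hS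
  have : Module.Finite ℝ E := Module.finite_of_finrank_pos (by omega)
  have : IsFiniteMeasure (volume.restrict Ω') :=
    ⟨by rw [Measure.restrict_apply_univ]; exact hb'.measure_lt_top⟩
  let b : Module.Basis (Fin (k + 1)) ℝ E := Module.finBasisOfFinrankEq ℝ E hfin
  let u : Fin (k + 1) → E2 → ℝ := fun i => (b i : E2 → ℝ)
  have huE : ∀ c : Fin (k + 1) → ℝ, ∑ i, c i • u i ∈ E := fun c =>
    E.sum_mem fun i _ => E.smul_mem _ (b i).2
  have hu0 : ∀ c : Fin (k + 1) → ℝ, c ≠ 0 → ∑ i, c i • u i ≠ 0 := by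
    intro c hc h
    apply hc
    have h2 : ∑ i, c i • b i = 0 := Subtype.ext (by simpa [u] using h)
    exact funext (Fintype.linearIndependent_iff.1 b.linearIndependent c h2)
  have hrep : ∀ v ∈ E, ∃ c : Fin (k + 1) → ℝ, v = ∑ i, c i • u i := fun v hv =>
    ⟨b.repr ⟨v, hv⟩, by
      have := congrArg Subtype.val (b.sum_repr ⟨v, hv⟩)
      simpa only [Submodule.coe_sum, Submodule.coe_smul, u] using this.symm⟩
  choose K hK using fun i => hLip (u i) (hsm _ (b i).2)
  choose g hgs hgb hgd hgt hgdt using fun i => (hK i).exists_contDiff_approx (μ := volume)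
  let f : Fin (k + 1) → E2 → ℝ := fun i => T (u i)
  have hTc : ∀ c : Fin (k + 1) → ℝ, T (∑ i, c i • u i) = ∑ i, c i • f i := fun c => by
    simp [f, map_sum]
  have hmem : ∀ᵐ x ∂(volume.restrict Ω'), x ∈ closure Ω' := by
    have : ∀ᵐ x ∂(volume.restrict (closure Ω')), x ∈ closure Ω' :=
      ae_restrict_mem isClosed_closure.measurableSet
    exact ae_mono (Measure.restrict_mono subset_closure le_rfl) this
  choose C hC using fun i =>
    hb'.isCompact_closure.exists_bound_of_continuousOn (hK i).continuous.continuousOn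
  have hfm : ∀ i, AEStronglyMeasurable (f i) (volume.restrict Ω') := fun i =>
    (hK i).continuous.aestronglyMeasurable
  have hfb : ∀ i, ∀ᵐ x ∂(volume.restrict Ω'), ‖f i x‖ ≤ C i + K i := fun i =>
    hmem.mono fun x hx => (hC i x hx).trans (by simp)
  have hgfm : ∀ i, AEStronglyMeasurable (gradient (f i)) (volume.restrict Ω') := fun i =>
    (measurable_gradient _).aestronglyMeasurable
  have hgfb : ∀ i, ∀ᵐ x ∂(volume.restrict Ω'), ‖gradient (f i) x‖ ≤ K i := fun i =>
    Eventually.of_forall fun x => by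
      rw [norm_gradient_eq]; exact norm_fderiv_le_of_lipschitz ℝ (hK i)
  have hgm : ∀ i n, AEStronglyMeasurable (g i n) (volume.restrict Ω') := fun i n =>
    (hgs i n).continuous.aestronglyMeasurable
  have hgb' : ∀ i n, ∀ᵐ x ∂(volume.restrict Ω'), ‖g i n x‖ ≤ C i + K i := fun i n =>
    hmem.mono fun x hx => by
      have h1 := hgb i n x
      have h2 := hC i x hx
      calc ‖g i n x‖ = ‖T (u i) x + (g i n x - T (u i) x)‖ := by congr 1; ring
        _ ≤ _ := (norm_add_le _ _).trans (add_le_add h2 h1)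
  have hggm : ∀ i n, AEStronglyMeasurable (gradient (g i n)) (volume.restrict Ω') := fun i n =>
    (measurable_gradient _).aestronglyMeasurable
  have hggb : ∀ i n, ∀ᵐ x ∂(volume.restrict Ω'), ‖gradient (g i n) x‖ ≤ K i := fun i n =>
    Eventually.of_forall fun x => by rw [norm_gradient_eq]; exact hgd i n x
  let G : Fin (k + 1) → Fin (k + 1) → ℝ := fun i j => ∫ x in Ω', inner ℝ (f i x) (f j x)
  let D : Fin (k + 1) → Fin (k + 1) → ℝ := fun i j =>
    ∫ x in Ω', inner ℝ (gradient (f i) x) (gradient (f j) x)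
  let Gn : ℕ → Fin (k + 1) → Fin (k + 1) → ℝ := fun n i j =>
    ∫ x in Ω', inner ℝ (g i n x) (g j n x)
  let Dn : ℕ → Fin (k + 1) → Fin (k + 1) → ℝ := fun n i j =>
    ∫ x in Ω', inner ℝ (gradient (g i n) x) (gradient (g j n) x)
  have hGn : ∀ i j, Tendsto (fun n => Gn n i j) atTop (𝓝 (G i j)) := fun i j =>
    tendsto_integral_inner_of_bounded (hgm i) (hgm j) (hgb' i) (hgb' j)
      (Eventually.of_forall (hgt i)) (Eventually.of_forall (hgt j))
  have hgrad : ∀ i, ∀ᵐ x ∂(volume.restrict Ω'),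
      Tendsto (fun n => gradient (g i n) x) atTop (𝓝 (gradient (f i) x)) := fun i => by
    filter_upwards [ae_restrict_of_ae (hgdt i)] with x hx
    exact ((InnerProductSpace.toDual ℝ E2).symm.continuous.tendsto _).comp hx
  have hDn : ∀ i j, Tendsto (fun n => Dn n i j) atTop (𝓝 (D i j)) := fun i j =>
    tendsto_integral_inner_of_bounded (hggm i) (hggm j) (hggb i) (hggb j) (hgrad i) (hgrad j)
  have hG : ∀ c : Fin (k + 1) → ℝ,
      ∑ i, ∑ j, c i * c j * G i j = ∫ x in Ω, ((∑ i, c i • u i) x) ^ 2 := fun c => by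
    rw [← hmass _ (hsm _ (huE c)), hTc, ← integral_norm_sq_sum_smul hfm hfb c]
    refine integral_congr_ae (Eventually.of_forall fun x => ?_)
    simp
  have hD : ∀ c : Fin (k + 1) → ℝ,
      ∑ i, ∑ j, c i * c j * D i j = ∫ x in Ω, ‖gradient (∑ i, c i • u i) x‖ ^ 2 := fun c => by
    rw [← henergy _ (hsm _ (huE c)), hTc, ← integral_norm_sq_sum_smul hgfm hgfb c]
    refine integral_congr_ae ?_
    filter_upwards [ae_restrict_of_ae (ae_all_iff.2 fun i => (hK i).ae_differentiableAt)] with x hx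
    rw [gradient_sum_smul hx]
  have hGnc : ∀ n (c : Fin (k + 1) → ℝ),
      ∑ i, ∑ j, c i * c j * Gn n i j = ∫ x in Ω', ((∑ i, c i • g i n) x) ^ 2 := fun n c => by
    rw [← integral_norm_sq_sum_smul (fun i => hgm i n) (fun i => hgb' i n) c]
    refine integral_congr_ae (Eventually.of_forall fun x => ?_)
    simp
  have hDnc : ∀ n (c : Fin (k + 1) → ℝ),
      ∑ i, ∑ j, c i * c j * Dn n i j = ∫ x in Ω', ‖gradient (∑ i, c i • g i n) x‖ ^ 2 :=
    fun n c => by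
    rw [← integral_norm_sq_sum_smul (fun i => hggm i n) (fun i => hggb i n) c]
    refine integral_congr_ae (Eventually.of_forall fun x => ?_)
    simp only
    rw [gradient_sum_smul fun i => (hgs i n).differentiable (by simp) x]
  have hGpos : ∀ c : Fin (k + 1) → ℝ, c ≠ 0 → 0 < ∑ i, ∑ j, c i * c j * G i j := fun c hc => by
    rw [hG]
    exact setIntegral_sq_pos ho hb (hsm _ (huE c)).continuous
      fun h => hu0 c hc (hinj _ (huE c) h)
  have hlin : ∀ (M N : Fin (k + 1) → Fin (k + 1) → ℝ) (t : ℝ) (c : Fin (k + 1) → ℝ),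
      ∑ i, ∑ j, c i * c j * (t * M i j - N i j)
        = t * ∑ i, ∑ j, c i * c j * M i j - ∑ i, ∑ j, c i * c j * N i j := fun M N t c => by
    simp only [Finset.mul_sum, ← Finset.sum_sub_distrib]
    exact Finset.sum_congr rfl fun i _ => Finset.sum_congr rfl fun j _ => by ring
  have hlin2 : ∀ (M N : Fin (k + 1) → Fin (k + 1) → ℝ) (t : ℝ) (c : Fin (k + 1) → ℝ),
      ∑ i, ∑ j, c i * c j * (M i j - t * N i j)
        = ∑ i, ∑ j, c i * c j * M i j - t * ∑ i, ∑ j, c i * c j * N i j := fun M N t c => by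
    simp only [Finset.mul_sum, ← Finset.sum_sub_distrib]
    exact Finset.sum_congr rfl fun i _ => Finset.sum_congr rfl fun j _ => by ring
  have hbdd : BddAbove S := by
    have ht : ∀ i j, Tendsto (fun t : ℝ => G i j - t * D i j) (𝓝[>] 0) (𝓝 (G i j)) := fun i j => by
      have : Continuous fun t : ℝ => G i j - t * D i j := by fun_prop
      simpa using (this.tendsto 0).mono_left nhdsWithin_le_nhds
    obtain ⟨t, hpos, ht0⟩ :=
      ((eventually_forall_quadForm_pos ht hGpos).and self_mem_nhdsWithin).exists
    refine ⟨t⁻¹, ?_⟩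
    rintro q ⟨v, hv, hv0, rfl⟩
    obtain ⟨c, rfl⟩ := hrep v hv
    have hc : c ≠ 0 := fun h => hv0 (by simp [h])
    have h1 := hpos c hc
    rw [hlin2] at h1
    rw [← hG, ← hD, div_le_iff₀ (hGpos c hc), inv_mul_eq_div, le_div_iff₀ ht0]
    linarith
  have hr : ∀ c : Fin (k + 1) → ℝ, c ≠ 0 →
      ∑ i, ∑ j, c i * c j * D i j ≤ sSup S * ∑ i, ∑ j, c i * c j * G i j := fun c hc => by
    have := le_csSup hbdd ⟨_, huE c, hu0 c hc, rfl⟩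
    rwa [← hG, ← hD, div_le_iff₀ (hGpos c hc)] at this
  have hr0 : 0 ≤ sSup S := Real.sSup_nonneg fun q ⟨v, _, _, hq⟩ => by rw [hq]; positivity
  have hRpos : ∀ c : Fin (k + 1) → ℝ, c ≠ 0 →
      0 < ∑ i, ∑ j, c i * c j * ((sSup S + ε) * G i j - D i j) := fun c hc => by
    rw [hlin]
    nlinarith [hr c hc, mul_pos hε (hGpos c hc)]
  obtain ⟨n, hn1, hn2⟩ := ((eventually_forall_quadForm_pos hGn hGpos).and
    (eventually_forall_quadForm_pos
      (fun i j => ((hGn i j).const_mul (sSup S + ε)).sub (hDn i j)) hRpos)).exists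
  have hzero : ∀ c : Fin (k + 1) → ℝ, Set.EqOn (∑ i, c i • g i n) 0 Ω' → c = 0 := by
    intro c h
    by_contra hc
    have h1 := hn1 c hc
    have h2 : ∫ x in Ω', ((∑ i, c i • g i n) x) ^ 2 = 0 := by
      refine (setIntegral_eq_zero_of_forall_eq_zero fun x hx => ?_)
      rw [h hx]; simp
    rw [hGnc, h2] at h1
    exact lt_irrefl _ h1
  have hli : LinearIndependent ℝ fun i => g i n :=
    Fintype.linearIndependent_iff.2 fun c hc i =>
      congrFun (hzero c fun x _ => by rw [hc]) i
  refine ⟨_, ⟨Submodule.span ℝ (Set.range fun i => g i n), ?_, ?_, ?_, rfl⟩, ?_⟩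
  · rw [finrank_span_eq_card hli, Fintype.card_fin]
  · intro v hv
    obtain ⟨c, rfl⟩ := (Submodule.mem_span_range_iff_exists_fun ℝ).1 hv
    have : (∑ i, c i • g i n) = fun x => ∑ i, c i • g i n x := by ext x; simp
    rw [this]
    exact ContDiff.sum fun i _ => (hgs i n).const_smul (c i)
  · intro v hv h
    obtain ⟨c, rfl⟩ := (Submodule.mem_span_range_iff_exists_fun ℝ).1 hv
    rw [hzero c h]; simp
  · refine Real.sSup_le ?_ (by linarith)
    rintro q ⟨v, hv, hv0, rfl⟩
    obtain ⟨c, rfl⟩ := (Submodule.mem_span_range_iff_exists_fun ℝ).1 hv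
    have hc : c ≠ 0 := fun h => hv0 (by simp [h])
    have h2 := hn2 c hc
    rw [hlin] at h2
    rw [← hGnc, ← hDnc, div_le_iff₀ (hn1 c hc)]
    linarith

theorem sInf_le_sInf_of_forall_pos_exists_le {S S' : Set ℝ} (h0 : ∀ r ∈ S', 0 ≤ r)
    (hne : S'.Nonempty → S.Nonempty)
    (h : ∀ r ∈ S, ∀ ε > 0, ∃ r' ∈ S', r' ≤ r + ε) : sInf S' ≤ sInf S := by
  rcases S.eq_empty_or_nonempty with rfl | hS
  · have : S' = ∅ := Set.not_nonempty_iff_eq_empty.1 fun h' => by simpa using hne h'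
    rw [this]
  · refine le_csInf hS fun r hr => le_of_forall_pos_le_add fun ε hε => ?_
    obtain ⟨r', hr', hle⟩ := h r hr ε hε
    exact (csInf_le ⟨0, h0⟩ hr').trans hle

theorem nonneg_of_mem_rayleighSups {Ω : Set E2} {k : ℕ} {r : ℝ} (hr : r ∈ rayleighSups Ω k) :
    0 ≤ r := by
  obtain ⟨E, -, -, -, rfl⟩ := hr
  exact Real.sSup_nonneg fun q ⟨v, _, _, hq⟩ => by rw [hq]; positivity

end NeumannComparison

section Gluing

variable {V : Type*} [NormedAddCommGroup V] [NormedSpace ℝ V]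

/-- Extending a Lipschitz function by zero across its zero set preserves the Lipschitz constant. -/
theorem LipschitzWith.ite_nonneg_of_eq_zero {d ℓ : V → ℝ} {K : NNReal} (hd : LipschitzWith K d)
    (hℓ : Continuous ℓ) (h0 : ∀ x, ℓ x = 0 → d x = 0) :
    LipschitzWith K fun x => if 0 ≤ ℓ x then d x else 0 := by
  have key : ∀ x y, 0 ≤ ℓ x → ℓ y < 0 → |d x| ≤ K * dist x y := fun x y hx hy => by
    obtain ⟨z, hz, hz0⟩ := (convex_segment x y).isPreconnected.intermediate_value
      (right_mem_segment ℝ x y) (left_mem_segment ℝ x y) hℓ.continuousOn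
      (Set.mem_Icc.2 ⟨hy.le, hx⟩)
    have h1 := hd.dist_le_mul x z
    rw [h0 z hz0, Real.dist_eq, sub_zero] at h1
    refine h1.trans (mul_le_mul_of_nonneg_left ?_ K.2)
    have := dist_add_dist_of_mem_segment hz
    linarith [dist_nonneg (x := z) (y := y)]
  refine LipschitzWith.of_dist_le_mul fun x y => ?_
  rw [Real.dist_eq]
  by_cases hx : 0 ≤ ℓ x <;> by_cases hy : 0 ≤ ℓ y
  · simpa [hx, hy, Real.dist_eq] using hd.dist_le_mul x y
  · simpa [hx, hy] using key x y hx (not_le.1 hy)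
  · simpa [hx, hy, dist_comm] using key y x hy (not_le.1 hx)
  · simp only [hx, hy, if_false, sub_self, abs_zero]; positivity

end Gluing

section Tilings

local notation "E2" => EuclideanSpace ℝ (Fin 2)

/-- The open triangle with vertices `(0,0)`, `(1,0)`, `(1/2,1/2)`. -/
def refTile : Set E2 := {p | 0 < p 1 ∧ p 1 < p 0 ∧ p 0 + p 1 < 1}

/-- The closed triangle with vertices `(0,0)`, `(1,0)`, `(1/2,1/2)`. -/
def closedRefTile : Set E2 := {p | 0 ≤ p 1 ∧ p 1 ≤ p 0 ∧ p 0 + p 1 ≤ 1}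

theorem refTile_subset_closedRefTile : refTile ⊆ closedRefTile :=
  fun _ hp => ⟨hp.1.le, hp.2.1.le, hp.2.2.le⟩

theorem isOpen_refTile : IsOpen refTile :=
  IsOpen.inter (s := {p : E2 | 0 < p 1}) (isOpen_lt (by fun_prop) (by fun_prop))
    (IsOpen.inter (s := {p : E2 | p 1 < p 0}) (t := {p : E2 | p 0 + p 1 < 1})
      (isOpen_lt (by fun_prop) (by fun_prop)) (isOpen_lt (by fun_prop) (by fun_prop)))

theorem isClosed_closedRefTile : IsClosed closedRefTile :=
  IsClosed.inter (s₁ := {p : E2 | 0 ≤ p 1}) (isClosed_le (by fun_prop) (by fun_prop))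
    (IsClosed.inter (s₁ := {p : E2 | p 1 ≤ p 0}) (s₂ := {p : E2 | p 0 + p 1 ≤ 1})
      (isClosed_le (by fun_prop) (by fun_prop)) (isClosed_le (by fun_prop) (by fun_prop)))

theorem convex_refTile : Convex ℝ refTile := by
  rintro p ⟨h1, h2, h3⟩ q ⟨h4, h5, h6⟩ a b ha hb hab
  obtain rfl : b = 1 - a := by linarith
  simp only [refTile, Set.mem_ofPred_eq, PiLp.add_apply, PiLp.smul_apply, smul_eq_mul]
  rcases ha.eq_or_lt with rfl | ha
  · exact ⟨by linarith, by linarith, by linarith⟩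
  · refine ⟨?_, ?_, ?_⟩ <;> nlinarith

theorem convex_closedRefTile : Convex ℝ closedRefTile := by
  rintro p ⟨h1, h2, h3⟩ q ⟨h4, h5, h6⟩ a b ha hb hab
  obtain rfl : b = 1 - a := by linarith
  simp only [closedRefTile, Set.mem_ofPred_eq, PiLp.add_apply, PiLp.smul_apply, smul_eq_mul]
  refine ⟨?_, ?_, ?_⟩ <;> nlinarith

theorem isBounded_closedRefTile : Bornology.IsBounded closedRefTile := by
  refine (Metric.isBounded_closedBall (x := (0 : E2)) (r := 2)).subset ?_
  rintro p ⟨h1, h2, h3⟩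
  rw [mem_closedBall_zero_iff, EuclideanSpace.norm_eq]
  refine Real.sqrt_le_iff.2 ⟨by norm_num, ?_⟩
  simp only [Fin.sum_univ_two, Real.norm_eq_abs, sq_abs]
  nlinarith

theorem closedRefTile_subset_closure_refTile : closedRefTile ⊆ closure refTile := by
  rintro p ⟨h1, h2, h3⟩
  have hc : Continuous fun t : ℝ => p + t • (!₂[1 / 2, 1 / 4] - p) := by fun_prop
  refine mem_closure_of_tendsto (b := 𝓝[>] (0 : ℝ))
    (f := fun t : ℝ => p + t • (!₂[1 / 2, 1 / 4] - p))
    (by simpa using (hc.tendsto 0).mono_left nhdsWithin_le_nhds) ?_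
  filter_upwards [Ioo_mem_nhdsGT (one_pos : (0 : ℝ) < 1)] with t ht
  obtain ⟨ht0, ht1⟩ := ht
  simp only [refTile, Set.mem_ofPred_eq, PiLp.add_apply, PiLp.smul_apply, PiLp.sub_apply,
    smul_eq_mul]
  simp
  refine ⟨?_, ?_, ?_⟩ <;> nlinarith

theorem volume_closedRefTile_diff_refTile : volume (closedRefTile \ refTile) = 0 := by
  refine measure_mono_null ?_ (convex_refTile.addHaar_frontier volume)
  rw [frontier, isOpen_refTile.interior_eq]
  exact Set.sdiff_subset_sdiff_left closedRefTile_subset_closure_refTile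

theorem AffineIsometryEquiv.measurePreserving (φ : E2 ≃ᵃⁱ[ℝ] E2) :
    MeasurePreserving φ (volume : Measure E2) volume := by
  have h : (φ : E2 → E2) = (fun x => x + φ 0) ∘ φ.linearIsometryEquiv := by
    ext1 x
    have := φ.map_vadd 0 x
    simpa using this
  rw [h]
  exact (measurePreserving_add_right volume (φ 0)).comp φ.linearIsometryEquiv.measurePreserving

theorem AffineIsometryEquiv.measurableEmbedding (φ : E2 ≃ᵃⁱ[ℝ] E2) : MeasurableEmbedding φ :=
  φ.toHomeomorph.measurableEmbedding

theorem isOpen_image_refTile (φ : E2 ≃ᵃⁱ[ℝ] E2) : IsOpen (φ '' refTile) :=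
  φ.toHomeomorph.isOpenMap _ isOpen_refTile

theorem interior_iUnion_closedRefTile_ae_eq {ι : Type*} [Finite ι] (φ : ι → E2 ≃ᵃⁱ[ℝ] E2) :
    interior (⋃ i, φ i '' closedRefTile) =ᵐ[volume] ⋃ i, φ i '' refTile := by
  have h1 : (⋃ i, φ i '' refTile) ⊆ interior (⋃ i, φ i '' closedRefTile) :=
    interior_maximal (Set.iUnion_mono fun i => Set.image_mono refTile_subset_closedRefTile)
      (isOpen_iUnion fun i => isOpen_image_refTile (φ i))
  refine ae_eq_set.2 ⟨measure_mono_null (t := ⋃ i, φ i '' (closedRefTile \ refTile)) ?_ ?_, ?_⟩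
  · rintro x ⟨hx, hx'⟩
    obtain ⟨i, p, hp, rfl⟩ := Set.mem_iUnion.1 (interior_subset hx)
    refine Set.mem_iUnion.2 ⟨i, p, ⟨hp, fun hp' => hx' ?_⟩, rfl⟩
    exact Set.mem_iUnion.2 ⟨i, p, hp', rfl⟩
  · refine measure_iUnion_null fun i => ?_
    rw [← (φ i).measurePreserving.measure_preimage_emb (φ i).measurableEmbedding,
      Set.preimage_image_eq _ (φ i).injective, volume_closedRefTile_diff_refTile]
  · rw [Set.sdiff_eq_empty.2 h1, measure_empty]

/-- A region dissected (up to a null set) into seven congruent copies of the reference tile which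
are arranged along a tree: passing from `parent e` to `child e` means crossing the zero set of
`line e`, and `telescope` says that each line separates the tiles according to the tree.
The map `fold` folds the plane onto the reference tile, inverting all the tile maps. -/
structure TileTree (Ω : Set E2) where
  tile : Fin 7 → E2 ≃ᵃⁱ[ℝ] E2
  fold : E2 → E2
  root : Fin 7
  parent : Fin 6 → Fin 7
  child : Fin 6 → Fin 7
  line : Fin 6 → E2 → ℝ
  isOpen : IsOpen Ω
  isBounded : Bornology.IsBounded Ω
  ae_eq : Ω =ᵐ[volume] ⋃ j, tile j '' refTile
  lipschitz_fold : ∃ K, LipschitzWith K fold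
  fold_mem : ∀ x, fold x ∈ closedRefTile
  fold_tile : ∀ j, ∀ p ∈ refTile, fold (tile j p) = p
  continuous_line : ∀ e, Continuous (line e)
  telescope : ∀ j, ∀ p ∈ refTile, ∀ w : Fin 7 → ℝ,
    w root + ∑ e, (if 0 ≤ line e (tile j p) then w (child e) - w (parent e) else 0) = w j

namespace TileTree

variable {Ω Ω' : Set E2}

theorem pairwise_disjoint (S : TileTree Ω) :
    Pairwise (Function.onFun Disjoint fun j => S.tile j '' refTile) := by
  intro j k hjk
  refine Set.disjoint_left.2 ?_
  rintro _ ⟨p, hp, rfl⟩ ⟨q, hq, hqp⟩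
  have h1 := S.telescope j p hp (fun i => if i = j then 1 else 0)
  have h2 := S.telescope k q hq (fun i => if i = j then 1 else 0)
  rw [hqp, h1] at h2
  simp [hjk.symm] at h2

theorem integrableOn_comp_tile (S : TileTree Ω) {h : E2 → ℝ} (hh : IntegrableOn h Ω) (j : Fin 7) :
    IntegrableOn (fun p => h (S.tile j p)) refTile := by
  have h1 : IntegrableOn h (S.tile j '' refTile) :=
    (hh.congr_set_ae S.ae_eq.symm).mono_set (Set.subset_iUnion (fun j => S.tile j '' refTile) j)
  exact ((S.tile j).measurePreserving.integrableOn_image (S.tile j).measurableEmbedding).1 h1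

theorem setIntegral_eq (S : TileTree Ω) {h : E2 → ℝ} (hh : IntegrableOn h Ω) :
    ∫ x in Ω, h x = ∫ p in refTile, ∑ j, h (S.tile j p) := by
  rw [setIntegral_congr_set S.ae_eq, integral_iUnion_fintype
    (fun j => (isOpen_image_refTile _).measurableSet) S.pairwise_disjoint
    fun j => (hh.congr_set_ae S.ae_eq.symm).mono_set
      (Set.subset_iUnion (fun j => S.tile j '' refTile) j),
    integral_finsetSum _ fun j _ => S.integrableOn_comp_tile hh j]
  exact Finset.sum_congr rfl fun j _ =>
    (S.tile j).measurePreserving.setIntegral_image_emb (S.tile j).measurableEmbedding _ _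

/-- The restriction to the tile `j` of the transplantation of a function along the matrix `M`,
extended to the plane by folding. -/
noncomputable def piece (A : TileTree Ω) (B : TileTree Ω') (M : Fin 7 → Fin 7 → ℝ) (j : Fin 7) :
    (E2 → ℝ) →ₗ[ℝ] (E2 → ℝ) where
  toFun u x := ∑ i, M j i * u (A.tile i (B.fold x))
  map_add' u v := by
    ext x; simp [mul_add, Finset.sum_add_distrib]
  map_smul' c u := by
    ext x; simp only [Pi.smul_apply, smul_eq_mul, RingHom.id_apply, Finset.mul_sum]
    exact Finset.sum_congr rfl fun i _ => by ring

/-- Transplantation of functions along the matrix `M`. -/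
noncomputable def transplant (A : TileTree Ω) (B : TileTree Ω') (M : Fin 7 → Fin 7 → ℝ) :
    (E2 → ℝ) →ₗ[ℝ] (E2 → ℝ) where
  toFun u x := piece A B M B.root u x + ∑ e, (if 0 ≤ B.line e x then
    piece A B M (B.child e) u x - piece A B M (B.parent e) u x else 0)
  map_add' u v := by
    ext x
    simp only [map_add, Pi.add_apply]
    rw [add_add_add_comm, ← Finset.sum_add_distrib]
    congr 1
    refine Finset.sum_congr rfl fun e _ => ?_
    split_ifs <;> ring
  map_smul' c u := by
    ext x
    simp only [map_smul, Pi.smul_apply, smul_eq_mul, RingHom.id_apply, mul_add, Finset.mul_sum]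
    congr 1
    refine Finset.sum_congr rfl fun e _ => ?_
    split_ifs <;> ring

theorem transplant_tile (A : TileTree Ω) (B : TileTree Ω') (M : Fin 7 → Fin 7 → ℝ) (u : E2 → ℝ)
    (j : Fin 7) {p : E2} (hp : p ∈ refTile) :
    transplant A B M u (B.tile j p) = ∑ i, M j i * u (A.tile i p) := by
  have := B.telescope j p hp fun k => piece A B M k u (B.tile j p)
  refine Eq.trans this ?_
  change ∑ i, M j i * u (A.tile i (B.fold (B.tile j p))) = _
  rw [B.fold_tile j p hp]

theorem exists_lipschitzWith_piece (A : TileTree Ω) (B : TileTree Ω') (M : Fin 7 → Fin 7 → ℝ)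
    (j : Fin 7) {u : E2 → ℝ} (hu : ContDiff ℝ (⊤ : ℕ∞) u) :
    ∃ K, LipschitzWith K (piece A B M j u) := by
  obtain ⟨KF, hKF⟩ := B.lipschitz_fold
  have h1 : ∀ i, ∃ K, LipschitzWith K fun x => u (A.tile i (B.fold x)) := fun i => by
    have hc : IsCompact (A.tile i '' closedRefTile) :=
      (Metric.isCompact_of_isClosed_isBounded isClosed_closedRefTile
        isBounded_closedRefTile).image (A.tile i).continuous
    obtain ⟨K, hK⟩ := LocallyLipschitzOn.exists_lipschitzOnWith_of_compact hc
      ((hu.of_le (by simp)).locallyLipschitz.locallyLipschitzOn (s := A.tile i '' closedRefTile))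
    refine ⟨K * KF, LipschitzWith.of_dist_le_mul fun x y => ?_⟩
    have h2 := hK.dist_le_mul _ (Set.mem_image_of_mem (A.tile i) (B.fold_mem x))
      _ (Set.mem_image_of_mem (A.tile i) (B.fold_mem y))
    rw [(A.tile i).dist_map] at h2
    refine h2.trans ?_
    rw [NNReal.coe_mul, mul_assoc]
    exact mul_le_mul_of_nonneg_left (hKF.dist_le_mul x y) K.2
  choose K hK using h1
  refine ⟨∑ i, ‖M j i‖₊ * K i, ?_⟩
  have : ∀ s : Finset (Fin 7), LipschitzWith (∑ i ∈ s, ‖M j i‖₊ * K i)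
      fun x => ∑ i ∈ s, M j i * u (A.tile i (B.fold x)) := fun s => by
    induction s using Finset.induction_on with
    | empty => simp
    | insert i s hi ih =>
      simp only [Finset.sum_insert hi]
      exact ((lipschitzWith_smul (M j i)).comp (hK i)).add ih
  exact this Finset.univ

theorem exists_lipschitzWith_transplant (A : TileTree Ω) (B : TileTree Ω')
    {M : Fin 7 → Fin 7 → ℝ}
    (hglue : ∀ e x, B.line e x = 0 → ∀ u : E2 → ℝ,
      piece A B M (B.child e) u x = piece A B M (B.parent e) u x)
    {u : E2 → ℝ} (hu : ContDiff ℝ (⊤ : ℕ∞) u) :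
    ∃ K, LipschitzWith K (transplant A B M u) := by
  choose K hK using fun j => exists_lipschitzWith_piece A B M j hu
  refine ⟨K B.root + ∑ e, (K (B.child e) + K (B.parent e)), (hK B.root).add ?_⟩
  have : ∀ s : Finset (Fin 6), LipschitzWith (∑ e ∈ s, (K (B.child e) + K (B.parent e)))
      fun x => ∑ e ∈ s, (if 0 ≤ B.line e x then
        piece A B M (B.child e) u x - piece A B M (B.parent e) u x else 0) := fun s => by
    induction s using Finset.induction_on with
    | empty => simp
    | insert e s he ih =>
      simp only [Finset.sum_insert he]
      exact (((hK _).sub (hK _)).ite_nonneg_of_eq_zero (B.continuous_line e)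
        fun x hx => sub_eq_zero.2 (hglue e x hx u)).add ih
  exact this Finset.univ

theorem sum_norm_sq_sum_smul {H : Type*} [NormedAddCommGroup H] [InnerProductSpace ℝ H]
    {ι κ : Type*} [Fintype ι] [Fintype κ] [DecidableEq ι] {M : κ → ι → ℝ}
    (hM : ∀ i i', ∑ j, M j i * M j i' = if i = i' then 1 else 0) (v : ι → H) :
    ∑ j, ‖∑ i, M j i • v i‖ ^ 2 = ∑ i, ‖v i‖ ^ 2 := by
  have h1 : ∀ j, ‖∑ i, M j i • v i‖ ^ 2 = ∑ i, ∑ i', M j i * M j i' * inner ℝ (v i) (v i') :=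
    fun j => by
    rw [← real_inner_self_eq_norm_sq, sum_inner]
    refine Finset.sum_congr rfl fun i _ => ?_
    rw [inner_sum]
    refine Finset.sum_congr rfl fun i' _ => ?_
    rw [real_inner_smul_left, real_inner_smul_right, mul_assoc]
  simp_rw [h1]
  rw [Finset.sum_comm]
  refine Finset.sum_congr rfl fun i _ => ?_
  rw [Finset.sum_comm]
  simp_rw [← Finset.sum_mul, hM]
  simp

theorem hasFDerivAt_affineIsometryEquiv (φ : E2 ≃ᵃⁱ[ℝ] E2) (p : E2) :
    HasFDerivAt φ (φ.linearIsometryEquiv : E2 →L[ℝ] E2) p := by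
  have h : (φ : E2 → E2) = fun x => φ.linearIsometryEquiv x + φ 0 := by
    ext1 x
    have := φ.map_vadd 0 x
    simpa using this
  rw [h]
  exact (φ.linearIsometryEquiv : E2 →L[ℝ] E2).hasFDerivAt.add_const _

theorem norm_gradient_comp_affineIsometryEquiv (φ : E2 ≃ᵃⁱ[ℝ] E2) {u : E2 → ℝ} {p : E2}
    (hu : DifferentiableAt ℝ u (φ p)) :
    ‖gradient (fun x => u (φ x)) p‖ = ‖gradient u (φ p)‖ := by
  have h2 := (hu.hasFDerivAt.comp p (hasFDerivAt_affineIsometryEquiv φ p)).fderiv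
  rw [norm_gradient_eq, norm_gradient_eq]
  change ‖fderiv ℝ (u ∘ φ) p‖ = _
  rw [h2]
  exact ContinuousLinearMap.opNorm_comp_linearIsometryEquiv _ _

theorem exists_rayleighSups_le (A : TileTree Ω) (B : TileTree Ω') {M : Fin 7 → Fin 7 → ℝ}
    (hM : ∀ i i', ∑ j, M j i * M j i' = if i = i' then 1 else 0)
    (hglue : ∀ e x, B.line e x = 0 → ∀ u : E2 → ℝ,
      piece A B M (B.child e) u x = piece A B M (B.parent e) u x)
    {k : ℕ} {r : ℝ} (hr : r ∈ rayleighSups Ω k) {ε : ℝ} (hε : 0 < ε) :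
    ∃ r' ∈ rayleighSups Ω' k, r' ≤ r + ε := by
  have hL := fun u (hu : ContDiff ℝ (⊤ : ℕ∞) u) => exists_lipschitzWith_transplant A B hglue hu
  have hcont : ∀ {h : E2 → ℝ} {s : Set E2}, Continuous h → Bornology.IsBounded s →
      IntegrableOn h s := fun hh hs =>
    (hh.continuousOn.integrableOn_compact hs.isCompact_closure).mono_set subset_closure
  refine _root_.exists_rayleighSups_le A.isOpen A.isBounded B.isBounded (transplant A B M) hL
    (fun u hu => ?_) (fun u hu => ?_) hr hε
  · obtain ⟨K, hK⟩ := hL u hu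
    rw [A.setIntegral_eq (h := fun x => u x ^ 2) (hcont (hu.continuous.pow 2) A.isBounded),
      B.setIntegral_eq (h := fun x => transplant A B M u x ^ 2)
        (hcont (hK.continuous.pow 2) B.isBounded)]
    refine setIntegral_congr_fun isOpen_refTile.measurableSet fun p hp => ?_
    simp only [transplant_tile A B M u _ hp]
    simpa using sum_norm_sq_sum_smul hM fun i => u (A.tile i p)
  · obtain ⟨K, hK⟩ := hL u hu
    have hdiff : Differentiable ℝ u := hu.differentiable (by simp)
    have hgc : Continuous (gradient u) :=
      (InnerProductSpace.toDual ℝ E2).symm.continuous.comp (hu.continuous_fderiv (by simp))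
    have hT : IntegrableOn (fun x => ‖gradient (transplant A B M u) x‖ ^ 2) Ω' := by
      refine Measure.integrableOn_of_bounded (M := (K : ℝ) ^ 2) B.isBounded.measure_lt_top.ne
        ((measurable_gradient _).norm.pow_const 2).aestronglyMeasurable
        (Eventually.of_forall fun x => ?_)
      rw [norm_pow, norm_norm, norm_gradient_eq]
      exact pow_le_pow_left₀ (norm_nonneg _) (norm_fderiv_le_of_lipschitz ℝ hK) 2
    rw [A.setIntegral_eq (h := fun x => ‖gradient u x‖ ^ 2) (hcont (hgc.norm.pow 2) A.isBounded),
      B.setIntegral_eq hT]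
    refine setIntegral_congr_fun isOpen_refTile.measurableSet fun p hp => ?_
    have h1 : ∀ i, DifferentiableAt ℝ (fun x => u (A.tile i x)) p := fun i =>
      (hdiff _).comp p (hasFDerivAt_affineIsometryEquiv _ p).differentiableAt
    have h2 : ∀ j, (fun x => transplant A B M u (B.tile j x)) =ᶠ[𝓝 p]
        ∑ i, M j i • fun x => u (A.tile i x) := fun j => by
      filter_upwards [isOpen_refTile.mem_nhds hp] with x hx
      simp [transplant_tile A B M u _ hx]
    have h3 : ∀ j, ‖gradient (transplant A B M u) (B.tile j p)‖
        = ‖∑ i, M j i • gradient (fun x => u (A.tile i x)) p‖ := fun j => by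
      rw [← gradient_sum_smul h1, ← (h2 j).gradient_eq]
      refine (norm_gradient_comp_affineIsometryEquiv _ ?_).symm
      have h4 : DifferentiableAt ℝ (fun x => transplant A B M u (B.tile j x)) p :=
        (h2 j).differentiableAt_iff.2 (DifferentiableAt.sum fun i _ => (h1 i).const_smul _)
      have h5 : DifferentiableAt ℝ (B.tile j).symm (B.tile j p) :=
        (hasFDerivAt_affineIsometryEquiv _ _).differentiableAt
      have h6 := DifferentiableAt.comp (B.tile j p)
        (g := fun x => transplant A B M u (B.tile j x)) (f := (B.tile j).symm)
        (by simpa using h4) h5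
      have h7 : (fun x => transplant A B M u (B.tile j x)) ∘ (B.tile j).symm
          = transplant A B M u := by
        ext x; simp
      rwa [h7] at h6
    simp only [h3]
    rw [sum_norm_sq_sum_smul hM]
    exact Finset.sum_congr rfl fun i _ => by
      rw [norm_gradient_comp_affineIsometryEquiv _ (hdiff _)]

end TileTree

end Tilings

section Polygons

local notation "E2" => EuclideanSpace ℝ (Fin 2)

/-- The plane isometry `(x, y) ↦ (a x + b y + e, c x + d y + f)`. -/
noncomputable def planeIsometry (a b c d e f : ℝ)
    (h : a ^ 2 + c ^ 2 = 1 ∧ b ^ 2 + d ^ 2 = 1 ∧ a * b + c * d = 0) : E2 ≃ᵃⁱ[ℝ] E2 :=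
  (LinearIsometry.toLinearIsometryEquiv (E₁ := E2) (F := E2)
    { toFun := fun p => !₂[a * p 0 + b * p 1, c * p 0 + d * p 1]
      map_add' := fun p q => by
        ext i; fin_cases i <;> simp <;> ring
      map_smul' := fun t p => by
        ext i; fin_cases i <;> simp <;> ring
      norm_map' := fun p => by
        obtain ⟨h1, h2, h3⟩ := h
        simp only [LinearMap.coe_mk, AddHom.coe_mk, EuclideanSpace.norm_eq, Fin.sum_univ_two,
          Real.norm_eq_abs, sq_abs]
        congr 1
        simp
        linear_combination p 0 ^ 2 * h1 + p 1 ^ 2 * h2 + 2 * p 0 * p 1 * h3 }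
    rfl).toAffineIsometryEquiv.trans (AffineIsometryEquiv.constVAdd ℝ E2 !₂[e, f])

theorem planeIsometry_apply {a b c d e f : ℝ}
    (h : a ^ 2 + c ^ 2 = 1 ∧ b ^ 2 + d ^ 2 = 1 ∧ a * b + c * d = 0) (p : E2) :
    planeIsometry a b c d e f h p = pt (a * p 0 + b * p 1 + e) (c * p 0 + d * p 1 + f) := by
  ext i; fin_cases i <;> simp [planeIsometry, pt, add_comm]

@[simp] theorem pt_apply_zero (a b : ℝ) : pt a b 0 = a := rfl

@[simp] theorem pt_apply_one (a b : ℝ) : pt a b 1 = b := rfl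

theorem closedRefTile_eq_tri : closedRefTile = tri (pt 0 0) (pt 1 0) (pt 0.5 0.5) := by
  refine Set.Subset.antisymm ?_ (convexHull_min ?_ convex_closedRefTile)
  · rintro p ⟨h1, h2, h3⟩
    have hp : ∑ i, ![1 - p 0 - p 1, p 0 - p 1, 2 * p 1] i •
        ![pt 0 0, pt 1 0, pt 0.5 0.5] i = p := by
      ext i; fin_cases i <;> simp [Fin.sum_univ_three] <;> ring
    rw [tri, ← hp]
    refine (convex_convexHull ℝ _).sum_mem (fun i _ => ?_) ?_ fun i _ => subset_convexHull ℝ _ ?_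
    · fin_cases i <;> simp <;> linarith
    · simp [Fin.sum_univ_three]; ring
    · fin_cases i <;> simp
  · rintro p (rfl | rfl | rfl) <;> simp only [closedRefTile, Set.mem_ofPred_eq] <;> norm_num

theorem image_closedRefTile_eq_tri (φ : E2 ≃ᵃⁱ[ℝ] E2) {p q s : E2}
    (h : ({φ (pt 0 0), φ (pt 1 0), φ (pt 0.5 0.5)} : Set E2) = {p, q, s}) :
    φ '' closedRefTile = tri p q s := by
  rw [closedRefTile_eq_tri, tri, tri, ← h]
  have := AffineMap.image_convexHull φ.toAffineEquiv.toAffineMap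
    ({pt 0 0, pt 1 0, pt 0.5 0.5} : Set E2)
  refine Eq.trans this ?_
  simp [Set.image_insert_eq, Set.image_singleton]

/-- The seven tiles of `gwwA`. -/
noncomputable def gwwTileA : Fin 7 → E2 ≃ᵃⁱ[ℝ] E2 :=
  ![planeIsometry 0 1 1 0 0 0 (by norm_num), planeIsometry 1 0 0 1 0 0 (by norm_num),
    planeIsometry 0 (-1) (-1) 0 1 1 (by norm_num), planeIsometry 0 1 (-1) 0 1 1 (by norm_num),
    planeIsometry 0 (-1) 1 0 2 0 (by norm_num), planeIsometry 1 0 0 (-1) 1 1 (by norm_num),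
    planeIsometry 1 0 0 1 1 1 (by norm_num)]

/-- The seven tiles of `gwwB`. -/
noncomputable def gwwTileB : Fin 7 → E2 ≃ᵃⁱ[ℝ] E2 :=
  ![planeIsometry (-1) 0 0 (-1) 1 0 (by norm_num), planeIsometry (-1) 0 0 1 1 0 (by norm_num),
    planeIsometry 0 1 (-1) 0 0 1 (by norm_num), planeIsometry 1 0 0 (-1) 0 1 (by norm_num),
    planeIsometry 1 0 0 1 0 1 (by norm_num), planeIsometry 0 (-1) (-1) 0 1 2 (by norm_num),
    planeIsometry 0 1 1 0 0 1 (by norm_num)]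

theorem gwwA_eq_interior : gwwA = interior (⋃ j, gwwTileA j '' closedRefTile) := by
  have h : (⋃ j, gwwTileA j '' closedRefTile) = gwwTileA 0 '' closedRefTile ∪
      gwwTileA 1 '' closedRefTile ∪ gwwTileA 2 '' closedRefTile ∪ gwwTileA 3 '' closedRefTile ∪
      gwwTileA 4 '' closedRefTile ∪ gwwTileA 5 '' closedRefTile ∪ gwwTileA 6 '' closedRefTile := by
    ext x
    simp only [Set.mem_iUnion, Set.mem_union, Fin.exists_fin_succ, Fin.exists_fin_zero]
    simp [or_assoc]
  rw [h, gwwA]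
  congr <;> refine (image_closedRefTile_eq_tri _ ?_).symm <;>
    simp only [gwwTileA, planeIsometry_apply, pt_apply_zero, pt_apply_one, Matrix.cons_val] <;>
    norm_num <;> ext x <;> simp only [Set.mem_insert_iff, Set.mem_singleton_iff] <;> tauto

theorem gwwB_eq_interior : gwwB = interior (⋃ j, gwwTileB j '' closedRefTile) := by
  have h : (⋃ j, gwwTileB j '' closedRefTile) = gwwTileB 0 '' closedRefTile ∪
      gwwTileB 1 '' closedRefTile ∪ gwwTileB 2 '' closedRefTile ∪ gwwTileB 3 '' closedRefTile ∪
      gwwTileB 4 '' closedRefTile ∪ gwwTileB 5 '' closedRefTile ∪ gwwTileB 6 '' closedRefTile := by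
    ext x
    simp only [Set.mem_iUnion, Set.mem_union, Fin.exists_fin_succ, Fin.exists_fin_zero]
    simp [or_assoc]
  rw [h, gwwB]
  congr <;> refine (image_closedRefTile_eq_tri _ ?_).symm <;>
    simp only [gwwTileB, planeIsometry_apply, pt_apply_zero, pt_apply_one, Matrix.cons_val] <;>
    norm_num <;> ext x <;> simp only [Set.mem_insert_iff, Set.mem_singleton_iff] <;> tauto

theorem isBounded_interior_iUnion_closedRefTile {ι : Type*} [Finite ι] (φ : ι → E2 ≃ᵃⁱ[ℝ] E2) :
    Bornology.IsBounded (interior (⋃ i, φ i '' closedRefTile)) :=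
  (Bornology.isBounded_iUnion.2 fun i =>
    (φ i).isometry.lipschitz.isBounded_image isBounded_closedRefTile).subset interior_subset

/-- The distance from `t` to the closest even integer. -/
noncomputable def triangleWave (t : ℝ) : ℝ := ‖(t : AddCircle (2 : ℝ))‖

theorem triangleWave_nonneg (t : ℝ) : 0 ≤ triangleWave t := norm_nonneg _

theorem triangleWave_le_one (t : ℝ) : triangleWave t ≤ 1 := by
  simpa [triangleWave] using
    AddCircle.norm_le_half_period (x := (t : AddCircle (2 : ℝ))) 2 two_ne_zero

theorem triangleWave_neg (t : ℝ) : triangleWave (-t) = triangleWave t := by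
  simp [triangleWave]

theorem triangleWave_two_sub (t : ℝ) : triangleWave (2 - t) = triangleWave t := by
  simp [triangleWave, AddCircle.coe_period]

theorem triangleWave_of_abs_le {t : ℝ} (ht : |t| ≤ 1) : triangleWave t = |t| :=
  (AddCircle.norm_coe_eq_abs_iff 2 two_ne_zero).2 (by simpa using ht)

theorem triangleWave_one_sub (t : ℝ) : triangleWave (1 - t) = 1 - triangleWave t := by
  obtain ⟨s, hs, n, rfl⟩ : ∃ s ∈ Set.Ioc (-1 : ℝ) 1, ∃ n : ℤ, t = s + n * 2 := by
    obtain ⟨n, hn, -⟩ := existsUnique_sub_zsmul_mem_Ioc (two_pos : (0 : ℝ) < 2) t (-1)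
    exact ⟨t - n • 2, by norm_num at hn ⊢; exact hn, n, by simp⟩
  have h1 : triangleWave (s + n * 2) = triangleWave s := by
    rw [triangleWave, triangleWave, ← zsmul_eq_mul]
    simp
  have h2 : triangleWave (1 - (s + n * 2)) = triangleWave (1 - s) := by
    rw [← sub_sub, triangleWave, triangleWave, ← zsmul_eq_mul]
    simp [AddCircle.coe_period]
  rw [h1, h2, triangleWave_of_abs_le (abs_le.2 ⟨hs.1.le, hs.2⟩)]
  rcases le_total 0 s with h | h
  · rw [triangleWave_of_abs_le (abs_le.2 ⟨by linarith [hs.2], by linarith⟩), abs_of_nonneg h,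
      abs_of_nonneg (by linarith [hs.2])]
  · rw [← triangleWave_two_sub, triangleWave_of_abs_le
      (abs_le.2 ⟨by linarith [hs.1], by linarith⟩), abs_of_nonpos h,
      abs_of_nonneg (by linarith [hs.1])]
    ring

theorem lipschitzWith_triangleWave : LipschitzWith 1 triangleWave := by
  refine LipschitzWith.of_dist_le_mul fun x y => ?_
  rw [NNReal.coe_one, one_mul, Real.dist_eq, Real.dist_eq]
  refine (abs_norm_sub_norm_le _ _).trans ?_
  rw [← AddCircle.coe_sub]
  exact QuotientAddGroup.norm_mk_le_norm

/-- Folding of the unit square onto `closedRefTile`. -/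
noncomputable def squareFold (x y : ℝ) : E2 :=
  pt (min (max x y) (1 - min x y)) (min (min x y) (1 - max x y))

theorem squareFold_mem {x y : ℝ} (hx : x ∈ Set.Icc 0 1) (hy : y ∈ Set.Icc 0 1) :
    squareFold x y ∈ closedRefTile := by
  obtain ⟨hx0, hx1⟩ := hx
  obtain ⟨hy0, hy1⟩ := hy
  simp only [squareFold, closedRefTile, Set.mem_ofPred_eq, pt_apply_zero, pt_apply_one]
  have h0 : 0 ≤ min x y := le_min hx0 hy0
  have h1 : min x y ≤ max x y := min_le_max
  have h2 : max x y ≤ 1 := max_le hx1 hy1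
  rcases le_total (max x y) (1 - min x y) with h | h
  · rw [min_eq_left h, min_eq_left (by linarith)]
    exact ⟨h0, h1, by linarith⟩
  · rw [min_eq_right h, min_eq_right (by linarith)]
    exact ⟨by linarith, by linarith, by linarith⟩

theorem squareFold_of_mem {x y : ℝ} (h0 : y ≤ x) (h1 : x + y ≤ 1) : squareFold x y = pt x y := by
  rw [squareFold, max_eq_left h0, min_eq_right h0, min_eq_left (by linarith),
    min_eq_left (by linarith)]

theorem squareFold_comm (x y : ℝ) : squareFold x y = squareFold y x := by
  rw [squareFold, squareFold, max_comm, min_comm x]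

theorem squareFold_one_sub (x y : ℝ) : squareFold (1 - x) (1 - y) = squareFold x y := by
  rw [squareFold, squareFold, min_sub_sub_left, max_sub_sub_left, sub_sub_cancel, sub_sub_cancel,
    min_comm, min_comm (1 - max x y)]

theorem squareFold_self (x : ℝ) : squareFold x x 0 = squareFold x x 1 := by
  simp [squareFold]

theorem squareFold_one_sub_self (x : ℝ) :
    squareFold x (1 - x) 0 + squareFold x (1 - x) 1 = 1 := by
  rcases le_total x (1 - x) with h | h <;> simp [squareFold, h]

theorem squareFold_zero_apply_one {x : ℝ} (hx : x ∈ Set.Icc 0 1) : squareFold x 0 1 = 0 := by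
  simp [squareFold, hx.1, hx.2]

theorem squareFold_one_apply_one {x : ℝ} (hx : x ∈ Set.Icc 0 1) : squareFold x 1 1 = 0 := by
  simp [squareFold, hx.1, hx.2]

/-- Folding of the plane onto `closedRefTile`. -/
noncomputable def planeFold (x : E2) : E2 := squareFold (triangleWave (x 0)) (triangleWave (x 1))

theorem triangleWave_mem (t : ℝ) : triangleWave t ∈ Set.Icc 0 1 :=
  ⟨triangleWave_nonneg t, triangleWave_le_one t⟩

theorem planeFold_mem (x : E2) : planeFold x ∈ closedRefTile :=
  squareFold_mem (triangleWave_mem _) (triangleWave_mem _)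

theorem LipschitzWith.pt {α : Type*} [PseudoMetricSpace α] {f g : α → ℝ} {K L : NNReal}
    (hf : LipschitzWith K f) (hg : LipschitzWith L g) :
    LipschitzWith (K + L) fun x => _root_.pt (f x) (g x) := by
  refine LipschitzWith.of_dist_le_mul fun x y => ?_
  rw [NNReal.coe_add, add_mul]
  refine le_trans ?_ (add_le_add (hf.dist_le_mul x y) (hg.dist_le_mul x y))
  rw [EuclideanSpace.dist_eq]
  refine Real.sqrt_le_iff.2 ⟨by positivity, ?_⟩
  simp only [Fin.sum_univ_two, pt_apply_zero, pt_apply_one]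
  nlinarith [dist_nonneg (x := f x) (y := f y), dist_nonneg (x := g x) (y := g y)]

theorem exists_lipschitzWith_planeFold : ∃ K, LipschitzWith K planeFold := by
  have h : ∀ i : Fin 2, ∃ K, LipschitzWith K fun x : E2 => triangleWave (x i) := fun i =>
    ⟨_, lipschitzWith_triangleWave.comp (EuclideanSpace.proj (𝕜 := ℝ) i).lipschitz⟩
  obtain ⟨K, hK⟩ := h 0
  obtain ⟨L, hL⟩ := h 1
  exact ⟨_, ((hK.max hL).min ((LipschitzWith.const 1).sub (hK.min hL))).pt
    ((hK.min hL).min ((LipschitzWith.const 1).sub (hK.max hL)))⟩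

theorem planeFold_apply_zero_eq {x : E2} (h : x 1 = x 0 ∨ x 1 = 2 - x 0) :
    planeFold x 0 = planeFold x 1 := by
  rcases h with h | h <;> simp only [planeFold, h, triangleWave_two_sub, squareFold_self]

theorem planeFold_apply_zero_add {x : E2} (h : x 1 = 1 - x 0 ∨ x 1 = x 0 + 1 ∨ x 0 = x 1 + 1) :
    planeFold x 0 + planeFold x 1 = 1 := by
  rcases h with h | h | h
  · simp only [planeFold, h, triangleWave_one_sub, squareFold_one_sub_self]
  · simp only [planeFold]
    rw [show x 1 = 1 - -x 0 by linarith, triangleWave_one_sub, triangleWave_neg,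
      squareFold_one_sub_self]
  · simp only [planeFold]
    rw [show x 0 = 1 - -x 1 by linarith, triangleWave_one_sub, triangleWave_neg,
      squareFold_comm, squareFold_one_sub_self]

theorem planeFold_apply_one_eq {x : E2} (h : x 0 = 1 ∨ x 1 = 0 ∨ x 1 = 1) :
    planeFold x 1 = 0 := by
  have h0 : triangleWave 0 = 0 := by simp [triangleWave_of_abs_le]
  have h1 : triangleWave 1 = 1 := by simp [triangleWave_of_abs_le]
  rcases h with h | h | h
  · simp only [planeFold, h, h1]
    rw [squareFold_comm, squareFold_one_apply_one (triangleWave_mem _)]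
  · simp only [planeFold, h, h0, squareFold_zero_apply_one (triangleWave_mem _)]
  · simp only [planeFold, h, h1, squareFold_one_apply_one (triangleWave_mem _)]

theorem triangleWave_of_mem {t : ℝ} (h0 : 0 ≤ t) (h1 : t ≤ 1) : triangleWave t = t := by
  rw [triangleWave_of_abs_le (abs_le.2 ⟨by linarith, h1⟩), abs_of_nonneg h0]

theorem triangleWave_one_add (t : ℝ) : triangleWave (1 + t) = 1 - triangleWave t := by
  rw [← sub_neg_eq_add, triangleWave_one_sub, triangleWave_neg]

theorem planeFold_gwwTileA (j : Fin 7) {p : E2} (hp : p ∈ refTile) :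
    planeFold (gwwTileA j p) = p := by
  obtain ⟨h0, h1, h2⟩ := hp
  have e0 := triangleWave_of_mem (t := p 0) (by linarith) (by linarith)
  have e1 := triangleWave_of_mem (t := p 1) (by linarith) (by linarith)
  have e2 : squareFold (p 0) (p 1) = p := by
    rw [squareFold_of_mem h1.le h2.le]
    ext i; fin_cases i <;> rfl
  have e3 := squareFold_comm (p 1) (p 0)
  rw [e2] at e3
  fin_cases j <;>
    simp [gwwTileA, planeIsometry_apply, planeFold, neg_add_eq_sub, add_comm _ (1 : ℝ),
      triangleWave_one_add, triangleWave_two_sub, triangleWave_neg,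
      squareFold_one_sub, e0, e1, e2, e3]

/-- The lines cutting `gwwA` into its tiles. -/
def gwwLineA : Fin 6 → E2 → ℝ :=
  ![fun x => x 0 - x 1, fun x => x 0 + x 1 - 1, fun x => x 0 - 1,
    fun x => x 0 + x 1 - 2, fun x => x 0 - x 1 - 1, fun x => x 1 - 1]

/-- The seven-tile dissection of `gwwA`. -/
noncomputable def gwwTreeA : TileTree gwwA where
  tile := gwwTileA
  fold := planeFold
  root := 0
  parent := ![0, 1, 2, 3, 5, 5]
  child := ![1, 2, 3, 5, 4, 6]
  line := gwwLineA
  isOpen := isOpen_interior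
  isBounded := gwwA_eq_interior ▸ isBounded_interior_iUnion_closedRefTile _
  ae_eq := gwwA_eq_interior ▸ interior_iUnion_closedRefTile_ae_eq _
  lipschitz_fold := exists_lipschitzWith_planeFold
  fold_mem := planeFold_mem
  fold_tile _ _ := planeFold_gwwTileA _
  continuous_line e := by fin_cases e <;> simp [gwwLineA] <;> fun_prop
  telescope j p hp w := by
    obtain ⟨h0, h1, h2⟩ := hp
    have h (e : Fin 6) : 0 ≤ gwwLineA e (gwwTileA j p) ↔
        (![![false, false, false, false, false, false],
        ![true, false, false, false, false, false],
        ![true, true, false, false, false, false],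
        ![true, true, true, false, false, false],
        ![true, true, true, true, true, false],
        ![true, true, true, true, false, false],
        ![true, true, true, true, false, true]] :
          Fin 7 → Fin 6 → Bool) j e = true := by
      fin_cases j <;> fin_cases e <;> simp [gwwLineA, gwwTileA, planeIsometry_apply] <;> linarith
    simp only [h]
    fin_cases j <;> simp [Fin.sum_univ_six]

theorem planeFold_gwwTileB (j : Fin 7) {p : E2} (hp : p ∈ refTile) :
    planeFold (gwwTileB j p) = pt (1 - p 0) (p 1) := by
  obtain ⟨h0, h1, h2⟩ := hp
  have e0 := triangleWave_of_mem (t := p 0) (by linarith) (by linarith)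
  have e1 := triangleWave_of_mem (t := p 1) (by linarith) (by linarith)
  have e2 := squareFold_of_mem (x := 1 - p 0) (y := p 1) (by linarith) (by linarith)
  have e3 := squareFold_comm (p 1) (1 - p 0)
  have e4 := squareFold_one_sub (1 - p 0) (p 1)
  have e5 := squareFold_comm (1 - p 1) (p 0)
  rw [sub_sub_cancel] at e4
  rw [e4] at e5
  rw [e2] at e3 e4 e5
  fin_cases j <;>
    simp [gwwTileB, planeIsometry_apply, planeFold, neg_add_eq_sub, add_comm _ (1 : ℝ),
      triangleWave_one_add, triangleWave_two_sub, triangleWave_neg,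
      e0, e1, e2, e3, e4, e5]

/-- The lines cutting `gwwB` into its tiles. -/
def gwwLineB : Fin 6 → E2 → ℝ :=
  ![fun x => x 1, fun x => x 1 - x 0, fun x => x 0 + x 1 - 1, fun x => x 1 - 1,
    fun x => x 0 + x 1 - 2, fun x => x 1 - x 0 - 1]

/-- The seven-tile dissection of `gwwB`. -/
noncomputable def gwwTreeB : TileTree gwwB where
  tile := gwwTileB
  fold x := pt (1 - planeFold x 0) (planeFold x 1)
  root := 0
  parent := ![0, 1, 2, 3, 4, 4]
  child := ![1, 2, 3, 4, 5, 6]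
  line := gwwLineB
  isOpen := isOpen_interior
  isBounded := gwwB_eq_interior ▸ isBounded_interior_iUnion_closedRefTile _
  ae_eq := gwwB_eq_interior ▸ interior_iUnion_closedRefTile_ae_eq _
  lipschitz_fold := by
    obtain ⟨K, hK⟩ := exists_lipschitzWith_planeFold
    have h := fun i : Fin 2 => (EuclideanSpace.proj (𝕜 := ℝ) i).lipschitz.comp hK
    exact ⟨_, ((LipschitzWith.const 1).sub (h 0)).pt (h 1)⟩
  fold_mem x := by
    obtain ⟨h0, h1, h2⟩ := planeFold_mem x
    exact ⟨h0, by simp; linarith, by simp; linarith⟩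
  fold_tile j p hp := by
    rw [planeFold_gwwTileB j hp]
    ext i; fin_cases i <;> simp
  continuous_line e := by fin_cases e <;> simp [gwwLineB] <;> fun_prop
  telescope j p hp w := by
    obtain ⟨h0, h1, h2⟩ := hp
    have h (e : Fin 6) : 0 ≤ gwwLineB e (gwwTileB j p) ↔
        (![![false, false, false, false, false, false],
        ![true, false, false, false, false, false],
        ![true, true, false, false, false, false],
        ![true, true, true, false, false, false],
        ![true, true, true, true, false, false],
        ![true, true, true, true, true, false],
        ![true, true, true, true, false, true]] :
          Fin 7 → Fin 6 → Bool) j e = true := by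
      fin_cases j <;> fin_cases e <;> simp [gwwLineB, gwwTileB, planeIsometry_apply] <;> linarith
    simp only [h]
    fin_cases j <;> simp [Fin.sum_univ_six]

/-- The transplantation matrix from `gwwA` to `gwwB`: its entries are `p` at the incidences of a
Fano plane, and `q` elsewhere. -/
def fanoMatrix (p q : ℝ) : Fin 7 → Fin 7 → ℝ :=
  ![![q, q, q, p, p, p, q], ![q, q, p, q, p, q, p], ![q, p, q, q, q, p, p],
    ![p, q, q, p, q, q, p], ![p, q, p, q, q, p, q], ![p, p, q, q, p, q, q],
    ![q, p, p, p, q, q, q]]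

theorem fanoMatrix_orthogonal_left {p q : ℝ} (h1 : 3 * p ^ 2 + 4 * q ^ 2 = 1)
    (h2 : p ^ 2 + 4 * p * q + 2 * q ^ 2 = 0) (i i' : Fin 7) :
    ∑ j, fanoMatrix p q j i * fanoMatrix p q j i' = if i = i' then 1 else 0 := by
  fin_cases i <;> fin_cases i' <;> simp [fanoMatrix, Fin.sum_univ_seven] <;> linarith

theorem fanoMatrix_orthogonal_right {p q : ℝ} (h1 : 3 * p ^ 2 + 4 * q ^ 2 = 1)
    (h2 : p ^ 2 + 4 * p * q + 2 * q ^ 2 = 0) (i i' : Fin 7) :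
    ∑ j, fanoMatrix p q i j * fanoMatrix p q i' j = if i = i' then 1 else 0 := by
  fin_cases i <;> fin_cases i' <;> simp [fanoMatrix, Fin.sum_univ_seven] <;> linarith

theorem exists_fano_weights : ∃ p q : ℝ, 3 * p ^ 2 + 4 * q ^ 2 = 1 ∧
    p ^ 2 + 4 * p * q + 2 * q ^ 2 = 0 := by
  have h : √2 ^ 2 = (2 : ℝ) := Real.sq_sqrt zero_le_two
  refine ⟨(1 + 2 * √2) / 7, (2 - 3 * √2) / 14, ?_, ?_⟩ <;> ring_nf <;> rw [h] <;> norm_num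

theorem gwwTileA_eq_of_apply_eq {p : E2} (h : p 0 = p 1) :
    gwwTileA 1 p = gwwTileA 0 p ∧ gwwTileA 5 p = gwwTileA 3 p := by
  simp [gwwTileA, planeIsometry_apply, h]

theorem gwwTileA_eq_of_apply_add {p : E2} (h : p 0 + p 1 = 1) :
    gwwTileA 2 p = gwwTileA 1 p ∧ gwwTileA 5 p = gwwTileA 4 p := by
  obtain h : p 1 = 1 - p 0 := by linarith
  constructor <;> simp [gwwTileA, planeIsometry_apply, h] <;> congr 1 <;> ring

theorem gwwTileA_eq_of_apply_one {p : E2} (h : p 1 = 0) :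
    gwwTileA 3 p = gwwTileA 2 p ∧ gwwTileA 6 p = gwwTileA 5 p := by
  simp [gwwTileA, planeIsometry_apply, h]

theorem gwwTileB_eq_of_apply_eq {p : E2} (h : p 0 = p 1) :
    gwwTileB 3 p = gwwTileB 2 p ∧ gwwTileB 6 p = gwwTileB 4 p := by
  simp [gwwTileB, planeIsometry_apply, h]

theorem gwwTileB_eq_of_apply_add {p : E2} (h : p 0 + p 1 = 1) :
    gwwTileB 2 p = gwwTileB 1 p ∧ gwwTileB 5 p = gwwTileB 4 p := by
  obtain h : p 1 = 1 - p 0 := by linarith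
  constructor <;> simp [gwwTileB, planeIsometry_apply, h] <;> congr 1 <;> ring

theorem gwwTileB_eq_of_apply_one {p : E2} (h : p 1 = 0) :
    gwwTileB 1 p = gwwTileB 0 p ∧ gwwTileB 4 p = gwwTileB 3 p := by
  simp [gwwTileB, planeIsometry_apply, h]

theorem gwwTreeB_glue (p q : ℝ) (e : Fin 6) (x : E2) (hx : gwwTreeB.line e x = 0) (u : E2 → ℝ) :
    gwwTreeA.piece gwwTreeB (fanoMatrix p q) (gwwTreeB.child e) u x =
      gwwTreeA.piece gwwTreeB (fanoMatrix p q) (gwwTreeB.parent e) u x := by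
  have ha (h : x 1 = x 0 ∨ x 1 = 2 - x 0) := gwwTileA_eq_of_apply_add
    (p := gwwTreeB.fold x) (by simp [gwwTreeB, planeFold_apply_zero_eq h])
  have hb (h : x 1 = 1 - x 0 ∨ x 1 = x 0 + 1 ∨ x 0 = x 1 + 1) := gwwTileA_eq_of_apply_eq
    (p := gwwTreeB.fold x) (by simp [gwwTreeB]; linarith [planeFold_apply_zero_add h])
  have hc (h : x 0 = 1 ∨ x 1 = 0 ∨ x 1 = 1) := gwwTileA_eq_of_apply_one
    (p := gwwTreeB.fold x) (by simp [gwwTreeB, planeFold_apply_one_eq h])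
  simp only [TileTree.piece, LinearMap.coe_mk, AddHom.coe_mk, Fin.sum_univ_seven]
  generalize gwwTreeB.fold x = y at *
  fin_cases e <;> simp [gwwTreeA, gwwTreeB, gwwLineB, fanoMatrix] at hx ⊢
  · rw [(hc (.inr (.inl hx))).1, (hc (.inr (.inl hx))).2]; ring
  · rw [(ha (.inl (by linarith))).1, (ha (.inl (by linarith))).2]; ring
  · rw [(hb (.inl (by linarith))).1, (hb (.inl (by linarith))).2]; ring
  · rw [(hc (.inr (.inr (by linarith)))).1, (hc (.inr (.inr (by linarith)))).2]; ring
  · rw [(ha (.inr (by linarith))).1, (ha (.inr (by linarith))).2]; ring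
  · rw [(hb (.inr (.inl (by linarith)))).1, (hb (.inr (.inl (by linarith)))).2]; ring

theorem gwwTreeA_glue (p q : ℝ) (e : Fin 6) (x : E2) (hx : gwwTreeA.line e x = 0) (u : E2 → ℝ) :
    gwwTreeB.piece gwwTreeA (fun i j => fanoMatrix p q j i) (gwwTreeA.child e) u x =
      gwwTreeB.piece gwwTreeA (fun i j => fanoMatrix p q j i) (gwwTreeA.parent e) u x := by
  have ha (h : x 1 = x 0 ∨ x 1 = 2 - x 0) := gwwTileB_eq_of_apply_eq
    (p := gwwTreeA.fold x) (by simp [gwwTreeA, planeFold_apply_zero_eq h])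
  have hb (h : x 1 = 1 - x 0 ∨ x 1 = x 0 + 1 ∨ x 0 = x 1 + 1) := gwwTileB_eq_of_apply_add
    (p := gwwTreeA.fold x) (by simp [gwwTreeA, planeFold_apply_zero_add h])
  have hc (h : x 0 = 1 ∨ x 1 = 0 ∨ x 1 = 1) := gwwTileB_eq_of_apply_one
    (p := gwwTreeA.fold x) (by simp [gwwTreeA, planeFold_apply_one_eq h])
  simp only [TileTree.piece, LinearMap.coe_mk, AddHom.coe_mk, Fin.sum_univ_seven]
  generalize gwwTreeA.fold x = y at *
  fin_cases e <;> simp [gwwTreeA, gwwTreeB, gwwLineA, fanoMatrix] at hx ⊢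
  · rw [(ha (.inl (by linarith))).1, (ha (.inl (by linarith))).2]; ring
  · rw [(hb (.inl (by linarith))).1, (hb (.inl (by linarith))).2]; ring
  · rw [(hc (.inl (by linarith))).1, (hc (.inl (by linarith))).2]; ring
  · rw [(ha (.inr (by linarith))).1, (ha (.inr (by linarith))).2]; ring
  · rw [(hb (.inr (.inr (by linarith)))).1, (hb (.inr (.inr (by linarith)))).2]; ring
  · rw [(hc (.inr (.inr (by linarith)))).1, (hc (.inr (.inr (by linarith)))).2]; ring

end Polygons

/-- Gordon–Webb–Wolpert, Neumann case: the two GWW polygons are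
Neumann isospectral. -/
theorem gww_neumann_isospectral :
    ∀ k : ℕ, neumannEig gwwA k = neumannEig gwwB k := by
  obtain ⟨p, q, h1, h2⟩ := exists_fano_weights
  intro k
  have hAB : ∀ r ∈ rayleighSups gwwA k, ∀ ε > 0, ∃ r' ∈ rayleighSups gwwB k, r' ≤ r + ε :=
    fun r hr ε hε => gwwTreeA.exists_rayleighSups_le gwwTreeB (fanoMatrix_orthogonal_left h1 h2)
      (gwwTreeB_glue p q) hr hε
  have hBA : ∀ r ∈ rayleighSups gwwB k, ∀ ε > 0, ∃ r' ∈ rayleighSups gwwA k, r' ≤ r + ε :=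
    fun r hr ε hε => gwwTreeB.exists_rayleighSups_le gwwTreeA (fanoMatrix_orthogonal_right h1 h2)
      (gwwTreeA_glue p q) hr hε
  have hne : (rayleighSups gwwA k).Nonempty ↔ (rayleighSups gwwB k).Nonempty :=
    ⟨fun ⟨r, hr⟩ => (hAB r hr 1 one_pos).imp fun _ h => h.1,
      fun ⟨r, hr⟩ => (hBA r hr 1 one_pos).imp fun _ h => h.1⟩
  change sInf (rayleighSups gwwA k) = sInf (rayleighSups gwwB k)
  exact le_antisymm
    (sInf_le_sInf_of_forall_pos_exists_le (fun _ => nonneg_of_mem_rayleighSups) hne.1 hBA)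
    (sInf_le_sInf_of_forall_pos_exists_le (fun _ => nonneg_of_mem_rayleighSups) hne.2 hAB)
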